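/- In A^tmf, the left ideal generated by the three elements x₁ := β, x₅ := Pβ − βP, and x₉ := P²β − βP² coincides with the two-sided ideal generated by β. (This is the algebraic content of part (2) of the paper's lemma, which identifies the A^tmf-module N₃ = A^tmf/(β) with the induced module A^tmf ⊗_ℬ 𝔽₃ over the exterior subalgebra ℬ = ⟨x₁, x₅, x₉⟩.) -/

import Mathlib

noncomputable section

abbrev F3 : Type := ZMod 3
abbrev FA : Type := FreeAlgebra F3 (Fin 2)

/-- The generator `β` of the free algebra. -/
def βF : FA := FreeAlgebra.ι F3 0

/-- The generator `P` (the Steenrod power `𝒫¹`) of the free algebra. -/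
def PF : FA := FreeAlgebra.ι F3 1

/-- The relations presenting `A^tmf`: `β² = 0`, `P³ = 0`, and
`βP²β − βPβP − PβPβ = 0`. -/
inductive AtmfRel : FA → FA → Prop
  | beta_sq : AtmfRel (βF * βF) 0
  | P_cube : AtmfRel (PF * PF * PF) 0
  | adem : AtmfRel (βF * PF * PF * βF - βF * PF * βF * PF - PF * βF * PF * βF) 0

/-- The `tmf` Steenrod algebra `A^tmf` of Henriques–Hill at the prime 3. -/
abbrev Atmf : Type := RingQuot AtmfRel

/-- The image of `β` in `A^tmf`. -/
def β : Atmf := RingQuot.mkAlgHom F3 AtmfRel βF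

/-- The image of `P` in `A^tmf`. -/
def P : Atmf := RingQuot.mkAlgHom F3 AtmfRel PF

/-- `x₁ = β`. -/
def x₁ : Atmf := β

/-- `x₅ = 𝒫¹β − β𝒫¹`. -/
def x₅ : Atmf := P * β - β * P

/-- `x₉ = (𝒫¹)²β − β(𝒫¹)²`. -/
def x₉ : Atmf := P * P * β - β * (P * P)

theorem P_mul_P_mul_P : P * P * P = 0 := by
  have h := RingQuot.mkAlgHom_rel F3 AtmfRel.P_cube
  rw [map_mul, map_mul, map_zero] at h
  exact h

/-- Elements of `A^tmf` can be treated by induction on expressions in `β` and `P`. -/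
theorem Atmf.induction {C : Atmf → Prop} (algebraMap : ∀ r : F3, C (algebraMap F3 Atmf r))
    (beta : C β) (power : C P) (mul : ∀ a b, C a → C b → C (a * b))
    (sum : ∀ a b, C a → C b → C (a + b)) (a : Atmf) : C a := by
  obtain ⟨w, rfl⟩ := RingQuot.mkAlgHom_surjective F3 AtmfRel a
  induction w using FreeAlgebra.induction with
  | grade0 r => simpa only [AlgHom.commutes] using algebraMap r
  | grade1 i =>
    fin_cases i
    · exact beta
    · exact power
  | mul a b ha hb => simpa only [map_mul] using mul _ _ ha hb
  | add a b ha hb => simpa only [map_add] using sum _ _ ha hb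

theorem span_x_eq_span_beta_mul_pow :
    Ideal.span {x₁, x₅, x₉} = Ideal.span {β, β * P, β * (P * P)} := by
  apply le_antisymm <;> rw [Ideal.span_le] <;> rintro z (rfl | rfl | rfl)
  · exact Ideal.subset_span (by simp [x₁])
  · exact sub_mem (Ideal.mul_mem_left _ _ (Ideal.subset_span (by simp)))
      (Ideal.subset_span (by simp))
  · exact sub_mem (Ideal.mul_mem_left _ _ (Ideal.subset_span (by simp)))
      (Ideal.subset_span (by simp))
  · exact Ideal.subset_span (by simp [x₁])
  · have h : β * P = P * x₁ - x₅ := by simp [x₁, x₅]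
    rw [h]
    exact sub_mem (Ideal.mul_mem_left _ _ (Ideal.subset_span (by simp)))
      (Ideal.subset_span (by simp))
  · have h : β * (P * P) = P * P * x₁ - x₉ := by simp [x₁, x₉]
    rw [h]
    exact sub_mem (Ideal.mul_mem_left _ _ (Ideal.subset_span (by simp)))
      (Ideal.subset_span (by simp))

theorem mul_P_mem_span {z : Atmf} (hz : z ∈ Ideal.span {β, β * P, β * (P * P)}) :
    z * P ∈ Ideal.span {β, β * P, β * (P * P)} := by
  induction hz using Submodule.span_induction with
  | mem y hy =>
    rcases hy with rfl | rfl | rfl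
    · exact Ideal.subset_span (by simp)
    · exact Ideal.subset_span (by simp [mul_assoc])
    · rw [mul_assoc, P_mul_P_mul_P, mul_zero]
      exact zero_mem _
  | zero => simp
  | add y w _ _ hy hw => simpa only [add_mul] using add_mem hy hw
  | smul a y _ hy =>
    rw [smul_eq_mul, mul_assoc]
    exact Ideal.mul_mem_left _ a hy

instance isTwoSided_span_beta_mul_pow :
    (Ideal.span {β, β * P, β * (P * P)}).IsTwoSided where
  mul_mem_of_left {z} a hz := by
    induction a using Atmf.induction generalizing z with
    | algebraMap r =>
      rw [← Algebra.commutes]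
      exact Ideal.mul_mem_left _ _ hz
    | beta => exact Ideal.mul_mem_left _ _ (Ideal.subset_span (by simp))
    | power => exact mul_P_mem_span hz
    | mul a b ha hb =>
      rw [← mul_assoc z a b]
      exact hb (ha hz)
    | sum a b ha hb =>
      rw [mul_add]
      exact add_mem (ha hz) (hb hz)

/-- In `A^tmf`, the left ideal generated by `x₁`, `x₅`, `x₉` coincides with the
two-sided ideal generated by `β`. -/
theorem left_ideal_eq_twoSidedIdeal :
    ∀ z : Atmf, z ∈ Ideal.span {x₁, x₅, x₉} ↔ z ∈ TwoSidedIdeal.span {β} := by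
  intro z
  rw [span_x_eq_span_beta_mul_pow]
  constructor
  · have hβ : β ∈ TwoSidedIdeal.span {β} := TwoSidedIdeal.subset_span rfl
    have hle : Ideal.span {β, β * P, β * (P * P)} ≤
        TwoSidedIdeal.asIdeal (TwoSidedIdeal.span {β}) := by
      rw [Ideal.span_le]
      rintro y (rfl | rfl | rfl)
      · exact hβ
      · exact TwoSidedIdeal.mul_mem_right _ _ _ hβ
      · exact TwoSidedIdeal.mul_mem_right _ _ _ hβ
    exact fun hz => hle hz
  · have hle : TwoSidedIdeal.span {β} ≤
        (Ideal.span {β, β * P, β * (P * P)}).toTwoSided := by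
      rw [TwoSidedIdeal.span_le]
      rintro y rfl
      exact Ideal.mem_toTwoSided.2 (Ideal.subset_span (by simp))
    exact fun hz => Ideal.mem_toTwoSided.1 (hle hz)
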